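/- Let b > 2 be an integer. Then for every integer λ ≥ 1 and every integer N ≥ 1 there exists an integer n ≥ N such that U_b((n+λ)!) ≢ U_b(n!) (mod b). -/

import Mathlib

/-- The "unit part" of `n` in base `b`: `n / b ^ v_b(n)` where `v_b(n)` is the largest
exponent `e` with `b ^ e ∣ n`. -/
def unitPart (b n : ℕ) : ℕ := n / b ^ padicValNat b n

lemma unitPart_spec (b n : ℕ) (hb : 2 < b) (hn : 0 < n) :
    n = b ^ padicValNat b n * unitPart b n ∧ ¬ b ∣ unitPart b n := by
  have h1 : b ^ padicValNat b n ∣ n := pow_padicValNat_dvd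
  have h2 : n = b ^ padicValNat b n * unitPart b n := (Nat.mul_div_cancel' h1).symm
  refine ⟨h2, ?_⟩
  rintro ⟨t, ht⟩
  have hfin : FiniteMultiplicity b n := Nat.finiteMultiplicity_iff.2 ⟨by omega, hn⟩
  have h3 : b ^ (padicValNat b n + 1) ∣ n := by
    refine ⟨t, ?_⟩
    rw [ht] at h2
    rw [pow_succ, mul_assoc]
    exact h2
  rw [padicValNat_def' (by omega) (by omega)] at h3
  exact hfin.not_pow_dvd_of_multiplicity_lt (Nat.lt_succ_self _) h3

lemma unitPart_unique_aux (b u w y z : ℕ) (hb : 2 < b)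
    (h : b ^ u * y = b ^ w * z) (hy : ¬ b ∣ y) : w ≤ u := by
  by_contra hlt
  push Not at hlt
  obtain ⟨s, rfl⟩ := Nat.exists_eq_add_of_lt hlt
  apply hy
  have hp : 0 < b ^ u := by positivity
  refine ⟨b ^ s * z, ?_⟩
  apply Nat.eq_of_mul_eq_mul_left hp
  rw [h]; ring

lemma unitPart_unique (b n v y : ℕ) (hb : 2 < b) (hn : 0 < n)
    (h : n = b ^ v * y) (hy : ¬ b ∣ y) : unitPart b n = y := by
  obtain ⟨h1, h2⟩ := unitPart_spec b n hb hn
  have e : b ^ v * y = b ^ padicValNat b n * unitPart b n := h.symm.trans h1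
  have i1 := unitPart_unique_aux b _ _ _ _ hb e hy
  have i2 := unitPart_unique_aux b _ _ _ _ hb e.symm h2
  have i3 := le_antisymm i1 i2
  rw [i3] at e
  exact (Nat.eq_of_mul_eq_mul_left (by positivity) e).symm

lemma exists_coprime_part (b : ℕ) (hb : 2 < b) : ∀ l : ℕ, 0 < l →
    ∃ k l', Nat.Coprime l' b ∧ 0 < l' ∧ l ∣ b ^ k * l' := by
  intro l
  induction l using Nat.strong_induction_on with
  | _ l ih =>
    intro hl
    by_cases hc : Nat.Coprime l b
    · exact ⟨0, l, hc, hl, by simp⟩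
    · obtain ⟨l1, h1⟩ := Nat.gcd_dvd_left l b
      have hg : 0 < Nat.gcd l b := Nat.gcd_pos_of_pos_left _ hl
      have hg1 : 1 < Nat.gcd l b := by
        have : Nat.gcd l b ≠ 1 := hc
        omega
      have hl1 : 0 < l1 := by
        rcases Nat.eq_zero_or_pos l1 with h | h
        · rw [h] at h1; omega
        · exact h
      have hlt : l1 < l := by nlinarith
      obtain ⟨k, l', a1, a2, a3⟩ := ih l1 hlt hl1
      refine ⟨k + 1, l', a1, a2, ?_⟩
      rw [h1, pow_succ', mul_assoc]
      exact mul_dvd_mul (Nat.gcd_dvd_right l b) a3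

lemma padicVal_le_two (p n : ℕ) (hp : p.Prime) :
    padicValNat p (n.factorial) ≤ padicValNat 2 (n.factorial) := by
  haveI := Fact.mk hp
  have h1 : Nat.log p n < n + 1 := Nat.lt_succ_of_le (Nat.log_le_self _ _)
  have h2 : Nat.log 2 n < n + 1 := Nat.lt_succ_of_le (Nat.log_le_self _ _)
  rw [padicValNat_factorial h1, padicValNat_factorial h2]
  apply Finset.sum_le_sum
  intro i _
  exact Nat.div_le_div_left (Nat.pow_le_pow_left hp.two_le i) (by positivity)

theorem unitPart_factorial_not_modEq (b : ℕ) (hb : 2 < b) (l : ℕ) (hl : 1 ≤ l)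
    (N : ℕ) (hN : 1 ≤ N) :
    ∃ n ≥ N, ¬ Nat.ModEq b (unitPart b (Nat.factorial (n + l))) (unitPart b (Nat.factorial n)) := by
  by_contra hcon
  push Not at hcon
  have H : ∀ q n, N ≤ n →
      Nat.ModEq b (unitPart b (Nat.factorial (n + q * l))) (unitPart b (Nat.factorial n)) := by
    intro q
    induction q with
    | zero => intro n _; simp only [Nat.zero_mul, Nat.add_zero]; exact Nat.ModEq.refl _
    | succ q ih =>
      intro n hn
      have := hcon (n + q * l) (by omega)
      rw [show n + (q + 1) * l = n + q * l + l by ring]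
      exact this.trans (ih n hn)
  obtain ⟨n1, hn1⟩ : ∃ n1, n1 = l * (N + 1) := ⟨_, rfl⟩
  have hn1N : N + 1 ≤ n1 := by rw [hn1]; nlinarith
  obtain ⟨c, hc⟩ : ∃ c, c = unitPart b (n1 - 1).factorial := ⟨_, rfl⟩
  obtain ⟨d, hd⟩ : ∃ d, d = unitPart b n1.factorial := ⟨_, rfl⟩
  have Hn : ∀ n, n1 ≤ n → l ∣ n → Nat.ModEq b (unitPart b (n - 1).factorial) c ∧
      Nat.ModEq b (unitPart b n.factorial) d := by
    intro n hn hln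
    have h1 : l ∣ n - n1 := Nat.dvd_sub hln ⟨N + 1, hn1⟩
    obtain ⟨q, hq⟩ := h1
    have a1 := H q (n1 - 1) (by omega)
    have a2 := H q n1 (by omega)
    rw [mul_comm q l, ← hq] at a1 a2
    rw [show n1 - 1 + (n - n1) = n - 1 by omega] at a1
    rw [show n1 + (n - n1) = n by omega] at a2
    rw [hc, hd]
    exact ⟨a1, a2⟩
  have hbc : ¬ b ∣ c := by
    rw [hc]; exact (unitPart_spec b _ hb (Nat.factorial_pos _)).2
  obtain ⟨k0, l', hcop, hl', hdvd⟩ := exists_coprime_part b hb l hl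
  have key : ∀ r, ¬ b ∣ r * c → Nat.ModEq b (r * c) d := by
    intro r hr
    obtain ⟨m0, hm1, hm2⟩ := Nat.chineseRemainder hcop 0 r
    obtain ⟨m, hm⟩ : ∃ m, m = m0 + l' * b := ⟨_, rfl⟩
    have hmpos : 0 < m := by
      have : 0 < l' * b := by positivity
      omega
    have hml : l' ∣ m := by
      rw [hm]; exact dvd_add ((Nat.modEq_zero_iff_dvd).1 hm1) (dvd_mul_right _ _)
    have hmr : Nat.ModEq b m r := by
      rw [hm]
      have : Nat.ModEq b (l' * b) 0 := (Nat.modEq_zero_iff_dvd).2 (dvd_mul_left _ _)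
      simpa using hm2.add this
    obtain ⟨k, hk⟩ : ∃ k, k = k0 + n1 := ⟨_, rfl⟩
    have hkb : k < b ^ k := Nat.lt_pow_self (by omega)
    have hge : n1 ≤ b ^ k * m := by nlinarith
    have hln : l ∣ b ^ k * m := by
      refine hdvd.trans (mul_dvd_mul (pow_dvd_pow _ (by omega)) hml)
    obtain ⟨e1, e2⟩ := Hn _ hge hln
    obtain ⟨s1, s2⟩ := unitPart_spec b (b ^ k * m - 1).factorial hb (Nat.factorial_pos _)
    have hmod : Nat.ModEq b (m * unitPart b (b ^ k * m - 1).factorial) (r * c) := hmr.mul e1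
    have hU : unitPart b (b ^ k * m).factorial = m * unitPart b (b ^ k * m - 1).factorial := by
      apply unitPart_unique b _ (k + padicValNat b (b ^ k * m - 1).factorial) _ hb
        (Nat.factorial_pos _)
      · rw [← Nat.mul_factorial_pred (by omega : b ^ k * m ≠ 0)]
        conv_lhs => rw [s1]
        rw [pow_add]; ring
      · intro h
        exact hr ((hmod.dvd_iff (dvd_refl b)).1 h)
    rw [hU] at e2
    exact hmod.symm.trans e2
  have hcd : Nat.ModEq b c d := by simpa using key 1 (by simpa using hbc)
  have h2c : b ∣ 2 * c := by
    by_contra h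
    have h1 := (key 2 h).trans hcd.symm
    apply hbc
    have h3 : Nat.ModEq b (c + c) (c + 0) := by simpa [two_mul] using h1
    exact (Nat.modEq_zero_iff_dvd).1 (Nat.ModEq.add_left_cancel' c h3)
  have heven : 2 ∣ b := by
    by_contra h
    have : Nat.Coprime b 2 := ((Nat.Prime.coprime_iff_not_dvd Nat.prime_two).2 h).symm
    exact hbc (this.dvd_of_dvd_mul_left h2c)
  obtain ⟨h, rfl⟩ := heven
  have hh : 1 < h := by omega
  have form : ∀ x, 0 < x → Nat.ModEq (2 * h) (unitPart (2 * h) x) c →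
      ∃ v t, x = (2 * h) ^ v * (h * t) ∧ ¬ 2 ∣ t := by
    intro x hx hxc
    obtain ⟨s1, s2⟩ := unitPart_spec (2 * h) x hb hx
    have h2 : 2 * h ∣ 2 * unitPart (2 * h) x :=
      ((hxc.mul_left 2).dvd_iff (dvd_refl _)).2 h2c
    obtain ⟨t, ht⟩ := Nat.dvd_of_mul_dvd_mul_left (by norm_num) h2
    refine ⟨_, t, by rw [← ht]; exact s1, ?_⟩
    intro h2t
    apply s2
    rw [ht, mul_comm 2 h]
    exact mul_dvd_mul_left h h2t
  have val : ∀ x v t, x = (2 * h) ^ v * (h * t) → ¬ 2 ∣ t →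
      padicValNat 2 x + 1 = (padicValNat 2 h + 1) * (v + 1) := by
    intro x v t hx ht
    have ht0 : t ≠ 0 := by rintro rfl; simp at ht
    have hh0 : h ≠ 0 := by omega
    rw [hx, padicValNat.mul (by positivity) (by positivity), padicValNat.pow,
      padicValNat.mul (by norm_num) hh0, padicValNat.mul hh0 ht0,
      padicValNat.eq_zero_of_not_dvd ht, padicValNat.self (by norm_num)]
    ring
  have dv : ∀ n, n1 ≤ n → l ∣ n → padicValNat 2 h + 1 ∣ padicValNat 2 n := by
    intro n hn hln
    obtain ⟨e1, e2⟩ := Hn n hn hln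
    obtain ⟨v, t, hv, ht⟩ := form _ (Nat.factorial_pos _) e1
    obtain ⟨v', t', hv', ht'⟩ := form _ (Nat.factorial_pos _) (e2.trans hcd.symm)
    have w := val _ _ _ hv ht
    have w' := val _ _ _ hv' ht'
    rw [← Nat.mul_factorial_pred (by omega : n ≠ 0),
      padicValNat.mul (by omega) (Nat.factorial_ne_zero _), add_assoc, w] at w'
    exact (Nat.dvd_add_left (dvd_mul_right _ _)).1 (w' ▸ dvd_mul_right _ _)
  have d1 := dv n1 le_rfl ⟨_, hn1⟩
  have d2 := dv (2 * n1) (by omega) (Dvd.dvd.mul_left ⟨_, hn1⟩ 2)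
  rw [padicValNat.mul (by norm_num) (by omega), padicValNat.self (by norm_num)] at d2
  have d3 : padicValNat 2 h + 1 = 1 := Nat.dvd_one.1 ((Nat.dvd_add_left d1).1 d2)
  obtain ⟨v, t, hv, ht⟩ := form (n1 - 1).factorial (Nat.factorial_pos _) (by rw [hc])
  have w := val _ _ _ hv ht
  rw [d3] at w
  have hp : (Nat.minFac h).Prime := Nat.minFac_prime (by omega)
  haveI := Fact.mk hp
  have hle := padicVal_le_two (Nat.minFac h) (n1 - 1) hp
  have hdv : (Nat.minFac h) ^ (v + 1) ∣ (n1 - 1).factorial := by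
    rw [hv, pow_succ]
    exact mul_dvd_mul (pow_dvd_pow_of_dvd (Dvd.dvd.mul_left (Nat.minFac_dvd h) 2) v)
      (Dvd.dvd.mul_right (Nat.minFac_dvd h) t)
  have := (padicValNat_dvd_iff_le (Nat.factorial_ne_zero _)).1 hdv
  omega
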